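/- For k = 2 and every integer j ≥ 0, there exist three ℝ-linearly independent homogeneous linear forms ℓ_1, ℓ_2, ℓ_3 ∈ S and three derivations θ_1, θ_2, θ_3 ∈ D_0(f_{j,2}), each homogeneous of degree 3j+5, such that the sequence 0 → S → S^3 → D_0(f_{j,2}) → 0 is exact, where the first map sends v to (ℓ_1·v, ℓ_2·v, ℓ_3·v) and the second sends (a_1,a_2,a_3) to Σ_i a_i·θ_i. (Equivalently, T_{A} ≅ T_{ℙ²}(−6−3j) for A = A_{A2}^{[−j,2+j]}.) -/

import Mathlib

open MvPolynomial

noncomputable section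

abbrev S := MvPolynomial (Fin 3) ℝ

/-- The module of logarithmic derivations killing `f`. -/
def D0 (f : S) : Submodule S (Derivation ℝ S S) where
  carrier := {θ | θ f = 0}
  add_mem' := by
    intro a b ha hb
    simp only [Set.mem_setOf_eq] at *
    simp [ha, hb]
  zero_mem' := by simp
  smul_mem' := by
    intro c θ hθ
    simp only [Set.mem_setOf_eq] at *
    simp [hθ]

def fjk (j k : ℕ) : S :=
  X 2 * ∏ s ∈ Finset.Icc (-(j : ℤ)) ((k : ℤ) + j),
    ((X 0 - C (s : ℝ) * X 2) * (X 1 - C (s : ℝ) * X 2) * (X 0 + X 1 - C (s : ℝ) * X 2))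

/-- A derivation is homogeneous of degree `d` if its values on variables are. -/
def IsHomogDer (θ : Derivation ℝ S S) (d : ℕ) : Prop :=
  ∀ i : Fin 3, (θ (X i)).IsHomogeneous d

/-! ### Linear forms, restriction to a line -/

theorem irr_linear {l : S} (h : l.IsHomogeneous 1) (h0 : l ≠ 0) : Irreducible l := by
  apply irreducible_of_totalDegree_eq_one (h.totalDegree h0)
  intro x hx
  rw [isUnit_iff_ne_zero]
  rintro rfl
  apply h0
  ext i
  simpa using hx i

theorem relprime_of_eval {l m : S} (h : Irreducible l) (u : Fin 3 → ℝ)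
    (h1 : eval u l = 0) (h2 : eval u m ≠ 0) : IsRelPrime l m := by
  rw [h.isRelPrime_iff_not_dvd]
  rintro ⟨q, rfl⟩
  simp [h1] at h2

theorem ne_zero_of_eval {l : S} (u : Fin 3 → ℝ) (h : eval u l ≠ 0) : l ≠ 0 := by
  rintro rfl; simp at h

theorem homog_sub_C {l : S} (h : l.IsHomogeneous 1) (r : ℝ) :
    (l - C r * X 2).IsHomogeneous 1 :=
  h.sub (isHomogeneous_C_mul_X _ _)

/-- dehomogenised restriction to the line `x = r z` -/
def ev (r : ℝ) : S →ₐ[ℝ] Polynomial ℝ := aeval ![Polynomial.C r, Polynomial.X, 1]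

/-- restriction to the plane `x = r z` -/
def sg (r : ℝ) : S →ₐ[ℝ] S := aeval ![C r * X 2, X 1, X 2]

@[simp] theorem ev_X0 (r : ℝ) : ev r (X 0) = Polynomial.C r := by simp [ev]
@[simp] theorem ev_X1 (r : ℝ) : ev r (X 1) = Polynomial.X := by simp [ev]
@[simp] theorem ev_X2 (r : ℝ) : ev r (X 2) = 1 := by simp [ev]
@[simp] theorem ev_C (r c : ℝ) : ev r (C c) = Polynomial.C c := by
  rw [← algebraMap_eq, AlgHom.commutes]; rfl
@[simp] theorem sg_X0 (r : ℝ) : sg r (X 0) = C r * X 2 := by simp [sg]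
@[simp] theorem sg_X1 (r : ℝ) : sg r (X 1) = X 1 := by simp [sg]
@[simp] theorem sg_X2 (r : ℝ) : sg r (X 2) = X 2 := by simp [sg]
@[simp] theorem sg_C (r c : ℝ) : sg r (C c) = C c := by
  rw [← algebraMap_eq, AlgHom.commutes]

theorem sg_homog {A : S} {d : ℕ} (h : A.IsHomogeneous d) (r : ℝ) : (sg r A).IsHomogeneous d := by
  have := h.aeval (n := 1) (![C r * X 2, X 1, X 2] : Fin 3 → S) (by
    intro i; fin_cases i
    · exact isHomogeneous_C_mul_X _ _
    · exact isHomogeneous_X _ _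
    · exact isHomogeneous_X _ _)
  simpa [sg] using this

theorem dvd_sub_sg (A : S) (r : ℝ) : (X 0 - C r * X 2) ∣ A - sg r A := by
  rw [← Ideal.mem_span_singleton, ← Ideal.Quotient.eq]
  have : (Ideal.Quotient.mkₐ ℝ (Ideal.span {(X 0 - C r * X 2 : S)})) =
      (Ideal.Quotient.mkₐ ℝ (Ideal.span {(X 0 - C r * X 2 : S)})).comp (sg r) := by
    apply MvPolynomial.algHom_ext
    intro i
    fin_cases i
    · simp only [Fin.zero_eta, AlgHom.comp_apply, sg_X0, Ideal.Quotient.mkₐ_eq_mk]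
      rw [Ideal.Quotient.eq, Ideal.mem_span_singleton]
    · simp
    · simp
  exact congrArg (fun f => f A) this

theorem eval_homog {A : S} {d : ℕ} (h : A.IsHomogeneous d) (c : ℝ) (u : Fin 3 → ℝ) :
    eval (fun i => c * u i) A = c ^ d * eval u A := by
  rw [eval_eq, eval_eq, Finset.mul_sum]
  apply Finset.sum_congr rfl
  intro m hm
  have hd : ∑ i ∈ m.support, m i = d := by
    have := h.degree_eq_sum_deg_support hm
    rw [this]
  simp_rw [mul_pow]
  rw [Finset.prod_mul_distrib, Finset.prod_pow_eq_pow_sum, hd]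
  ring

theorem eval_ev (A : S) (r t : ℝ) : (ev r A).eval t = eval ![r, t, 1] A := by
  have : ((Polynomial.aeval t : Polynomial ℝ →ₐ[ℝ] ℝ).comp (ev r)) =
      (aeval ![r, t, 1] : S →ₐ[ℝ] ℝ) := by
    apply MvPolynomial.algHom_ext
    intro i
    fin_cases i <;> simp
  have := congrArg (fun f => f A) this
  simp only [AlgHom.comp_apply, Polynomial.coe_aeval_eq_eval] at this
  exact this

theorem eval_sg (A : S) (r : ℝ) (u : Fin 3 → ℝ) :
    eval u (sg r A) = eval ![r * u 2, u 1, u 2] A := by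
  have : ((aeval u : S →ₐ[ℝ] ℝ).comp (sg r)) =
      (aeval ![r * u 2, u 1, u 2] : S →ₐ[ℝ] ℝ) := by
    apply MvPolynomial.algHom_ext
    intro i
    fin_cases i <;> simp
  have := congrArg (fun f => f A) this
  simp only [AlgHom.comp_apply] at this
  exact this

theorem sg_eq_zero_of_ev {A : S} {d : ℕ} (h : A.IsHomogeneous d) (r : ℝ) (h0 : ev r A = 0) :
    sg r A = 0 := by
  have : X 2 * sg r A = 0 := by
    apply MvPolynomial.funext
    intro u
    simp only [map_mul, eval_X, map_zero, eval_sg]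
    by_cases hu : u 2 = 0
    · simp [hu]
    · have : ![r * u 2, u 1, u 2] = fun i => u 2 * (![r, u 1 / u 2, 1] i) := by
        funext i
        fin_cases i
        · simp [mul_comm]
        · simp; field_simp
        · simp
      rw [this, eval_homog h, ← eval_ev, h0]
      simp
  rcases mul_eq_zero.1 this with h | h
  · exact absurd h (X_ne_zero 2)
  · exact h

theorem homog_factor {A α q : S} {d : ℕ} (hα : α.IsHomogeneous 1) (hA : A.IsHomogeneous (d + 1))
    (h : A = α * q) : ∃ q', q'.IsHomogeneous d ∧ A = α * q' := by
  refine ⟨homogeneousComponent d q, homogeneousComponent_isHomogeneous _ _, ?_⟩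
  have h1 : homogeneousComponent (d + 1) A = A := homogeneousComponent_eq_self hA
  rw [← h1, h]
  conv_lhs => rw [← sum_homogeneousComponent q, Finset.mul_sum, map_sum]
  have h2 : ∀ i, homogeneousComponent (d + 1) (α * homogeneousComponent i q) =
      if d = i then α * homogeneousComponent i q else 0 := by
    intro i
    rw [homogeneousComponent_of_mem (n := 1 + i)
      (hα.mul (homogeneousComponent_isHomogeneous i q))]
    by_cases hi : d = i
    · rw [if_pos (by omega), if_pos hi]
    · rw [if_neg (by omega), if_neg hi]
  simp_rw [h2]
  rw [Finset.sum_ite_eq]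
  split_ifs with h3
  · rfl
  · rw [homogeneousComponent_eq_zero, mul_zero]
    simp at h3; omega

/-- a homogeneous polynomial vanishing on the line is divisible by the linear form -/
theorem factor_of_ev {A : S} {d : ℕ} (h : A.IsHomogeneous (d + 1)) (r : ℝ) (h0 : ev r A = 0) :
    ∃ q, q.IsHomogeneous d ∧ A = (X 0 - C r * X 2) * q := by
  obtain ⟨q, hq⟩ := dvd_sub_sg A r
  rw [sg_eq_zero_of_ev h r h0, sub_zero] at hq
  exact homog_factor (homog_sub_C (isHomogeneous_X _ _) r) h hq

theorem natDegree_ev {A : S} {d : ℕ} (h : A.IsHomogeneous d) (r : ℝ) :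
    (ev r A).natDegree ≤ d := by
  rw [ev, aeval_def, eval₂_eq]
  apply Polynomial.natDegree_sum_le_of_forall_le
  intro m hm
  have hd : ∑ i ∈ m.support, m i = d := by
    have := h.degree_eq_sum_deg_support hm
    rw [this]
  refine Polynomial.natDegree_mul_le.trans ?_
  have h1 : (algebraMap ℝ (Polynomial ℝ) (coeff m A)).natDegree = 0 := Polynomial.natDegree_C _
  rw [h1, zero_add, ← hd]
  refine (Polynomial.natDegree_prod_le _ _).trans ?_
  apply Finset.sum_le_sum
  intro i _
  refine Polynomial.natDegree_pow_le.trans ?_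
  have : ((![Polynomial.C r, Polynomial.X, 1] : Fin 3 → Polynomial ℝ) i).natDegree ≤ 1 := by
    fin_cases i <;> simp
  calc _ ≤ m i * 1 := Nat.mul_le_mul_left _ this
    _ = m i := mul_one _

theorem lift_ev (p : Polynomial ℝ) {n : ℕ} (h : p.natDegree ≤ n) (r : ℝ) :
    ∃ P : S, P.IsHomogeneous n ∧ ev r P = p := by
  refine ⟨∑ k ∈ Finset.range (n + 1), C (p.coeff k) * (X 1 ^ k * X 2 ^ (n - k)), ?_, ?_⟩
  · apply IsHomogeneous.sum
    intro k hk
    apply IsHomogeneous.C_mul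
    have := (isHomogeneous_X_pow (R := ℝ) (1 : Fin 3) k).mul
      (isHomogeneous_X_pow (R := ℝ) (2 : Fin 3) (n - k))
    rwa [Nat.add_sub_cancel' (by simp at hk; omega)] at this
  · conv_rhs => rw [Polynomial.as_sum_range_C_mul_X_pow' p (Nat.lt_succ_of_le h)]
    simp

/-! ### Products of parallel linear forms and syzygies -/

/-- the product of the forms `l - s z` for `s ∈ I` -/
def Pr (l : S) (I : Finset ℤ) : S := ∏ s ∈ I, (l - C (s : ℝ) * X 2)

/-- the third linear form `-(x+y)` -/
def ww : S := -(X 0 + X 1)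

theorem homog_ww : ww.IsHomogeneous 1 :=
  ((isHomogeneous_X _ _).add (isHomogeneous_X _ _)).neg

theorem homog_Pr {l : S} (h : l.IsHomogeneous 1) (I : Finset ℤ) :
    (Pr l I).IsHomogeneous I.card := by
  have := IsHomogeneous.prod I (fun s : ℤ => l - C (s : ℝ) * X 2) (fun _ => 1)
    (fun s _ => homog_sub_C h s)
  simpa [Pr] using this

theorem Pr_insert (l : S) {I : Finset ℤ} {r : ℤ} (h : r ∉ I) :
    Pr l (insert r I) = (l - C (r : ℝ) * X 2) * Pr l I := Finset.prod_insert h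

/-- univariate products -/
def Pu (I : Finset ℤ) : Polynomial ℝ := ∏ s ∈ I, (Polynomial.X - Polynomial.C (s : ℝ))

theorem Pu_monic (I : Finset ℤ) : (Pu I).Monic :=
  Polynomial.monic_prod_of_monic _ _ fun _ _ => Polynomial.monic_X_sub_C _

theorem Pu_ne (I : Finset ℤ) : Pu I ≠ 0 := (Pu_monic I).ne_zero

theorem Pu_natDegree (I : Finset ℤ) : (Pu I).natDegree = I.card := by
  rw [Pu, Polynomial.natDegree_prod_of_monic _ _ fun _ _ => Polynomial.monic_X_sub_C _]
  simp only [Polynomial.natDegree_X_sub_C]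
  simp

theorem Pu_coprime {I J : Finset ℤ} (h : Disjoint I J) : IsCoprime (Pu I) (Pu J) := by
  apply IsCoprime.prod_left
  intro s hs
  apply IsCoprime.prod_right
  intro t ht
  apply Polynomial.isCoprime_X_sub_C_of_isUnit_sub
  rw [isUnit_iff_ne_zero, sub_ne_zero]
  intro hst
  have : s = t := by exact_mod_cast hst
  exact Finset.disjoint_left.1 h hs (this ▸ ht)

theorem Pu_inter_sdiff (I J : Finset ℤ) : Pu I = Pu (I ∩ J) * Pu (I \ J) := by
  rw [Pu, Pu, Pu, Finset.prod_inter_mul_prod_sdiff]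

theorem ev_Pr0 (r : ℤ) (I : Finset ℤ) (h : r ∉ I) :
    ∃ k : ℝ, k ≠ 0 ∧ ev r (Pr (X 0) I) = Polynomial.C k := by
  refine ⟨∏ s ∈ I, ((r : ℝ) - s), ?_, ?_⟩
  · rw [Finset.prod_ne_zero_iff]
    intro s hs h0
    have : r = s := by exact_mod_cast sub_eq_zero.1 h0
    exact h (this ▸ hs)
  · simp [Pr, map_prod]

theorem ev_Pr1 (r : ℤ) (I : Finset ℤ) : ev r (Pr (X 1) I) = Pu I := by
  simp [Pr, Pu, map_prod]

/-- reflection of an index set -/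
def rf (r : ℤ) (K : Finset ℤ) : Finset ℤ := K.image (fun t => -r - t)

theorem card_rf (r : ℤ) (K : Finset ℤ) : (rf r K).card = K.card :=
  Finset.card_image_of_injective _ (fun a b h => by simpa using h)

theorem ev_Prw (r : ℤ) (K : Finset ℤ) :
    ev r (Pr ww K) = Polynomial.C ((-1) ^ K.card) * Pu (rf r K) := by
  have : Pu (rf r K) = ∏ t ∈ K, (Polynomial.X - Polynomial.C (((-r - t : ℤ)) : ℝ)) := by
    rw [Pu, rf, Finset.prod_image]
    intro a _ b _ h
    simpa using h
  rw [this, Pr, map_prod, ← Finset.prod_const, map_prod, ← Finset.prod_mul_distrib]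
  apply Finset.prod_congr rfl
  intro t _
  simp [ww]
  ring

/-- homogeneous syzygies -/
structure Syz (I J K : Finset ℤ) (a : ℕ) (A B E : S) : Prop where
  eq : A * Pr (X 0) I + B * Pr (X 1) J + E * Pr ww K = 0
  hA : ∃ d, d + I.card = a ∧ A.IsHomogeneous d
  hB : ∃ d, d + J.card = a ∧ B.IsHomogeneous d
  hE : ∃ d, d + K.card = a ∧ E.IsHomogeneous d

/-- Hilbert–Burch data -/
def HB (I J K : Finset ℤ) (a b : ℕ) : Prop :=
  ∃ A₁ B₁ E₁ A₂ B₂ E₂ : S, Syz I J K a A₁ B₁ E₁ ∧ Syz I J K b A₂ B₂ E₂ ∧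
    B₁ * E₂ - B₂ * E₁ = Pr (X 0) I ∧ E₁ * A₂ - E₂ * A₁ = Pr (X 1) J ∧
    A₁ * B₂ - A₂ * B₁ = Pr ww K

theorem Syz.neg {I J K : Finset ℤ} {a : ℕ} {A B E : S} (h : Syz I J K a A B E) :
    Syz I J K a (-A) (-B) (-E) := by
  obtain ⟨h, ⟨d1, e1, h1⟩, ⟨d2, e2, h2⟩, ⟨d3, e3, h3⟩⟩ := h
  exact ⟨by linear_combination -h, ⟨d1, e1, h1.neg⟩, ⟨d2, e2, h2.neg⟩, ⟨d3, e3, h3.neg⟩⟩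

/-- multiplying and adding syzygies -/
theorem Syz.comb {I J K : Finset ℤ} {a b n : ℕ} {A B E A' B' E' c : S}
    (h : Syz I J K a A B E) (h' : Syz I J K b A' B' E') (hc : c.IsHomogeneous n)
    (hn : n + a = b) :
    Syz I J K b (A' - c * A) (B' - c * B) (E' - c * E) := by
  obtain ⟨h, ⟨d1, e1, h1⟩, ⟨d2, e2, h2⟩, ⟨d3, e3, h3⟩⟩ := h
  obtain ⟨h', ⟨d1', e1', h1'⟩, ⟨d2', e2', h2'⟩, ⟨d3', e3', h3'⟩⟩ := h'
  obtain rfl : d1' = n + d1 := by omega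
  obtain rfl : d2' = n + d2 := by omega
  obtain rfl : d3' = n + d3 := by omega
  exact ⟨by linear_combination h' - c * h, ⟨_, e1', h1'.sub (hc.mul h1)⟩,
    ⟨_, e2', h2'.sub (hc.mul h2)⟩, ⟨_, e3', h3'.sub (hc.mul h3)⟩⟩

theorem HB.swap {I J K : Finset ℤ} {a b : ℕ} (h : HB I J K a b) : HB I J K b a := by
  obtain ⟨A₁, B₁, E₁, A₂, B₂, E₂, s1, s2, m1, m2, m3⟩ := h
  refine ⟨A₂, B₂, E₂, -A₁, -B₁, -E₁, s2, s1.neg, ?_, ?_, ?_⟩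
  · linear_combination m1
  · linear_combination m2
  · linear_combination m3

/-- cyclic rotation of the coordinates -/
def rot : S →ₐ[ℝ] S := aeval ![ww, X 0, X 2]

theorem rot_X0 : rot (X 0) = ww := by simp [rot]
theorem rot_X1 : rot (X 1) = X 0 := by simp [rot]
theorem rot_X2 : rot (X 2) = X 2 := by simp [rot]
theorem rot_ww : rot ww = X 1 := by
  simp only [ww, map_neg, map_add, rot_X0, rot_X1]; ring
theorem rot_C (c : ℝ) : rot (C c) = C c := by
  rw [← algebraMap_eq, AlgHom.commutes]

theorem rot_Pr (l : S) (I : Finset ℤ) : rot (Pr l I) = Pr (rot l) I := by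
  simp [Pr, map_prod, rot_X2]

theorem rot_homog {A : S} {d : ℕ} (h : A.IsHomogeneous d) : (rot A).IsHomogeneous d := by
  have := h.aeval (n := 1) (![ww, X 0, X 2] : Fin 3 → S) (by
    intro i; fin_cases i
    · exact homog_ww
    · exact isHomogeneous_X _ _
    · exact isHomogeneous_X _ _)
  simpa only [rot, one_mul] using this

theorem Syz.rot {I J K : Finset ℤ} {a : ℕ} {A B E : S} (h : Syz I J K a A B E) :
    Syz J K I a (rot B) (rot E) (rot A) := by
  obtain ⟨h, ⟨d1, e1, h1⟩, ⟨d2, e2, h2⟩, ⟨d3, e3, h3⟩⟩ := h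
  refine ⟨?_, ⟨d2, e2, rot_homog h2⟩, ⟨d3, e3, rot_homog h3⟩, ⟨d1, e1, rot_homog h1⟩⟩
  have := congrArg _root_.rot h
  simp only [map_add, map_mul, rot_Pr, rot_X0, rot_X1, rot_ww, map_zero] at this
  linear_combination this

theorem HB.rot {I J K : Finset ℤ} {a b : ℕ} (h : HB I J K a b) : HB J K I a b := by
  obtain ⟨A₁, B₁, E₁, A₂, B₂, E₂, s1, s2, m1, m2, m3⟩ := h
  refine ⟨_, _, _, _, _, _, s1.rot, s2.rot, ?_, ?_, ?_⟩
  · rw [← rot_X1, ← rot_Pr, ← m2]; simp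
  · rw [← rot_ww, ← rot_Pr, ← m3]; simp
  · rw [← rot_X0, ← rot_Pr, ← m1]; simp

/-! ### Restricting syzygies to a line -/

theorem Syz.ev_eq {I J K : Finset ℤ} {a : ℕ} {A B E : S} (h : Syz I J K a A B E) (r : ℤ) :
    ev r A * ev r (Pr (X 0) I) + ev r B * Pu J +
      ev r E * (Polynomial.C ((-1) ^ K.card) * Pu (rf r K)) = 0 := by
  have := congrArg (ev r) h.eq
  simpa only [map_add, map_mul, ev_Pr1, ev_Prw, map_zero] using this

/-- the first component is divisible by the double points -/
theorem Syz.dvd {I J K : Finset ℤ} {a : ℕ} {A B E : S} (h : Syz I J K a A B E) (r : ℤ)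
    (hr : r ∉ I) {n : ℕ} (hn : n + (J ∪ rf r K).card = I.card + J.card + K.card) :
    ∃ c : Polynomial ℝ, ev r A = Pu (J ∩ rf r K) * c ∧ c.natDegree ≤ a - n := by
  obtain ⟨k, hk, hk'⟩ := ev_Pr0 r I hr
  have h1 := h.ev_eq r
  rw [hk', Pu_inter_sdiff J (rf r K), Pu_inter_sdiff (rf r K) J, Finset.inter_comm (rf r K)] at h1
  have h2 : Pu (J ∩ rf r K) ∣ ev r A := by
    have hu : IsUnit (Polynomial.C k) := Polynomial.isUnit_C.2 (isUnit_iff_ne_zero.2 hk)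
    rw [← hu.dvd_mul_right]
    refine ⟨-(ev r B * Pu (J \ rf r K) + ev r E * (Polynomial.C ((-1) ^ K.card) *
      Pu (rf r K \ J))), ?_⟩
    linear_combination h1
  obtain ⟨c, hc⟩ := h2
  refine ⟨c, hc, ?_⟩
  obtain ⟨d, hd, hA⟩ := h.hA
  have h3 := natDegree_ev hA r
  have h4 := Finset.card_union_add_card_inter J (rf r K)
  rw [card_rf] at h4
  by_cases hc0 : c = 0
  · subst hc0
    simp
  · rw [hc, Polynomial.natDegree_mul (Pu_ne _) hc0, Pu_natDegree] at h3
    omega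

/-- a syzygy of small degree tangent to the line vanishes on the line -/
theorem Syz.vanish {I J K : Finset ℤ} {a : ℕ} {A B E : S} (h : Syz I J K a A B E) (r : ℤ)
    (hn : a < (J ∪ rf r K).card) (h0 : ev r A = 0) : ev r B = 0 ∧ ev r E = 0 := by
  have h1 := h.ev_eq r
  rw [h0, Pu_inter_sdiff J (rf r K), Pu_inter_sdiff (rf r K) J, Finset.inter_comm (rf r K)] at h1
  have hp := Pu_ne (J ∩ rf r K)
  have h2 : ev r B * Pu (J \ rf r K) +
      ev r E * (Polynomial.C ((-1) ^ K.card) * Pu (rf r K \ J)) = 0 := by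
    apply mul_left_cancel₀ hp
    linear_combination h1
  have hu : IsUnit (Polynomial.C ((-1 : ℝ) ^ K.card)) :=
    Polynomial.isUnit_C.2 (isUnit_iff_ne_zero.2 (pow_ne_zero _ (by norm_num)))
  have h3 : Pu (J \ rf r K) ∣ ev r E := by
    have h4 : Pu (J \ rf r K) ∣ (ev r E * Polynomial.C ((-1) ^ K.card)) * Pu (rf r K \ J) :=
      ⟨-ev r B, by linear_combination h2⟩
    have h5 := (Pu_coprime (I := J \ rf r K) (J := rf r K \ J)
      disjoint_sdiff_sdiff).dvd_of_dvd_mul_right h4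
    exact hu.dvd_mul_right.1 h5
  have h6 : ev r E = 0 := by
    apply Polynomial.eq_zero_of_dvd_of_natDegree_lt h3
    obtain ⟨d, hd, hE⟩ := h.hE
    have h7 := natDegree_ev hE r
    have h8 := Finset.card_sdiff_add_card J (rf r K)
    rw [card_rf] at h8
    rw [Pu_natDegree]
    omega
  refine ⟨?_, h6⟩
  rw [h6, zero_mul, add_zero] at h2
  exact (mul_eq_zero.1 h2).resolve_right (Pu_ne _)

theorem ev_eq_C_mul {A : S} {r : ℤ} {p c : Polynomial ℝ} (h : ev r A = p * c)
    (hc : c.natDegree ≤ 0) : ∃ k : ℝ, ev r A = Polynomial.C k * p := by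
  obtain ⟨k, hk⟩ := Polynomial.natDegree_eq_zero.1 (Nat.le_zero.1 hc)
  exact ⟨k, by rw [h, mul_comm, ← hk]⟩

/-- adding a line: the generic step, when the first vector is transversal -/
theorem step_aux {I J K : Finset ℤ} {a n : ℕ} {r : ℤ} (hr : r ∉ I) (hI : I.card < a + n)
    {A₁ B₁ E₁ A₂ B₂ E₂ : S} (s1 : Syz I J K a A₁ B₁ E₁) (s2 : Syz I J K (n + a) A₂ B₂ E₂)
    (m1 : B₁ * E₂ - B₂ * E₁ = Pr (X 0) I) (m2 : E₁ * A₂ - E₂ * A₁ = Pr (X 1) J)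
    (m3 : A₁ * B₂ - A₂ * B₁ = Pr ww K) {p c : Polynomial ℝ} {k : ℝ} (hk : k ≠ 0)
    (h1 : ev r A₁ = Polynomial.C k * p) (h2 : ev r A₂ = p * c) (hc : c.natDegree ≤ n) :
    HB (insert r I) J K (a + 1) (n + a) := by
  obtain ⟨c', hc', hec⟩ := lift_ev (Polynomial.C k⁻¹ * c)
    ((Polynomial.natDegree_C_mul_le _ _).trans hc) r
  have s3 := s1.comb s2 hc' rfl
  have h3 : ev r (A₂ - c' * A₁) = 0 := by
    rw [map_sub, map_mul, h1, h2, hec]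
    have : (Polynomial.C k⁻¹ * Polynomial.C k : Polynomial ℝ) = 1 := by
      rw [← Polynomial.C_mul, inv_mul_cancel₀ hk, Polynomial.C_1]
    linear_combination (-p * c) * this
  obtain ⟨d, hd, hA⟩ := s3.hA
  obtain ⟨d, rfl⟩ : ∃ e, d = e + 1 := ⟨d - 1, by omega⟩
  obtain ⟨q, hq, hAq⟩ := factor_of_ev hA r h3
  set α : S := X 0 - C (r : ℝ) * X 2 with hα
  have hα1 : α.IsHomogeneous 1 := homog_sub_C (isHomogeneous_X _ _) _
  have hcard : (insert r I).card = I.card + 1 := Finset.card_insert_of_notMem hr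
  obtain ⟨d1, e1, g1⟩ := s1.hA
  obtain ⟨d2, e2, g2⟩ := s1.hB
  obtain ⟨d3, e3, g3⟩ := s1.hE
  refine ⟨A₁, α * B₁, α * E₁, q, B₂ - c' * B₁, E₂ - c' * E₁, ⟨?_, ⟨d1, by omega, g1⟩,
    ⟨1 + d2, by omega, hα1.mul g2⟩, ⟨1 + d3, by omega, hα1.mul g3⟩⟩,
    ⟨?_, ⟨d, by omega, hq⟩, s3.hB, s3.hE⟩, ?_, ?_, ?_⟩
  · rw [Pr_insert _ hr]
    linear_combination α * s1.eq
  · rw [Pr_insert _ hr]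
    linear_combination s3.eq - Pr (X 0) I * hAq
  · rw [Pr_insert _ hr]
    linear_combination α * m1
  · linear_combination m2 - E₁ * hAq
  · linear_combination m3 + B₁ * hAq

theorem step {I J K : Finset ℤ} {a n : ℕ} (h : HB I J K a (n + a)) (r : ℤ) (hr : r ∉ I)
    (hI : I.card < n + a) (hsum : I.card + J.card + K.card = a + (n + a))
    (hn : (J ∪ rf r K).card = n + a) :
    HB (insert r I) J K (a + 1) (n + a) := by
  obtain ⟨A₁, B₁, E₁, A₂, B₂, E₂, s1, s2, m1, m2, m3⟩ := h
  obtain ⟨c₁, hc₁, hd₁⟩ := s1.dvd r hr (n := a) (by omega)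
  obtain ⟨c₂, hc₂, hd₂⟩ := s2.dvd r hr (n := a) (by omega)
  obtain ⟨k₁, hk₁⟩ := ev_eq_C_mul hc₁ (by omega)
  have hF := ev_Pr0 r I hr
  obtain ⟨κ, hκ, hF⟩ := hF
  have hF0 : ev r (Pr (X 0) I) ≠ 0 := by rw [hF]; simpa using hκ
  by_cases h0 : k₁ = 0
  · have hA1 : ev r A₁ = 0 := by rw [hk₁, h0]; simp
    rcases Nat.eq_zero_or_pos n with rfl | hn0
    · obtain ⟨k₂, hk₂⟩ := ev_eq_C_mul hc₂ (by omega)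
      by_cases h2 : k₂ = 0
      · exfalso
        have hA2 : ev r A₂ = 0 := by rw [hk₂, h2]; simp
        have e1 := s1.ev_eq r
        have e2 := s2.ev_eq r
        rw [hA1] at e1
        rw [hA2] at e2
        apply hF0
        rw [← m1, map_sub, map_mul, map_mul]
        apply mul_left_cancel₀ (Pu_ne J)
        linear_combination ev r E₂ * e1 - ev r E₁ * e2
      · rw [zero_add] at s2 ⊢
        refine step_aux (n := 0) hr (by omega) s2 (A₂ := -A₁) (B₂ := -B₁) (E₂ := -E₁) ?_ ?_ ?_ ?_ h2
          hk₂ (c := -c₁) ?_ ?_ |> fun h => by simpa using h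
        · simpa using s1.neg
        · linear_combination m1
        · linear_combination m2
        · linear_combination m3
        · rw [map_neg, hc₁]; ring
        · rw [Polynomial.natDegree_neg]; omega
    · exfalso
      obtain ⟨hB, hE⟩ := s1.vanish r (by omega) hA1
      apply hF0
      rw [← m1]
      simp [hB, hE]
  · exact step_aux hr (by omega) s1 s2 m1 m2 m3 h0 hk₁ hc₂ (by omega)

theorem step_eq {I J K : Finset ℤ} {a : ℕ} (h : HB I J K a a) (r : ℤ) (hr : r ∉ I)
    (hI : I.card < a) (hsum : I.card + J.card + K.card = a + a)
    (hn : (J ∪ rf r K).card = a) :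
    HB (insert r I) J K a (a + 1) := by
  have := step (n := 0) (by simpa using h) r hr (by omega) (by simpa using hsum) (by simpa using hn)
  simpa using this.swap

theorem step_lt {I J K : Finset ℤ} {a : ℕ} (h : HB I J K a (a + 1)) (r : ℤ) (hr : r ∉ I)
    (hI : I.card < a + 1) (hsum : I.card + J.card + K.card = a + (a + 1))
    (hn : (J ∪ rf r K).card = a + 1) :
    HB (insert r I) J K (a + 1) (a + 1) := by
  have := step (n := 1) (by simpa [add_comm] using h) r hr (by omega) (by omega) (by omega)
  simpa [add_comm] using this

theorem union_rf {a b c d r lo hi : ℤ} (h : ∀ t, (lo ≤ t ∧ t ≤ hi) ↔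
    ((a ≤ t ∧ t ≤ b) ∨ (-r - d ≤ t ∧ t ≤ -r - c))) :
    (Finset.Icc a b ∪ rf r (Finset.Icc c d)) = Finset.Icc lo hi := by
  ext t
  simp only [rf, Finset.mem_union, Finset.mem_image, Finset.mem_Icc]
  rw [h t]
  constructor
  · rintro (h | ⟨s, hs, rfl⟩)
    · exact Or.inl h
    · right; omega
  · rintro (h | h)
    · exact Or.inl h
    · exact Or.inr ⟨-r - t, by omega, by omega⟩

theorem ins_left {a b r : ℤ} (h : r + 1 = a) (hab : a ≤ b + 1) :
    insert r (Finset.Icc a b) = Finset.Icc r b := by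
  ext t; simp only [Finset.mem_insert, Finset.mem_Icc]; omega

theorem ins_right {a b r : ℤ} (h : b + 1 = r) (hab : a ≤ b + 1) :
    insert r (Finset.Icc a b) = Finset.Icc a r := by
  ext t; simp only [Finset.mem_insert, Finset.mem_Icc]; omega

/-- the chain of free arrangements -/
theorem HB_chain (m : ℕ) : HB (Finset.Icc (1 - (m : ℤ)) m) (Finset.Icc (1 - (m : ℤ)) (m + 1))
    (Finset.Icc (-(m : ℤ) - 1) (m - 1)) (3 * m + 1) (3 * m + 1) := by
  induction m with
  | zero =>
    have e1 : Finset.Icc (1 - ((0 : ℕ) : ℤ)) ((0 : ℕ) : ℤ) = ∅ := by simp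
    have e2 : Finset.Icc (1 - ((0 : ℕ) : ℤ)) (((0 : ℕ) : ℤ) + 1) = {1} := by simp
    have e3 : Finset.Icc (-((0 : ℕ) : ℤ) - 1) (((0 : ℕ) : ℤ) - 1) = {-1} := by simp
    rw [e1, e2, e3]
    have p1 : Pr (X 0) ∅ = 1 := by simp [Pr]
    have p2 : Pr (X 1) {1} = X 1 - X 2 := by simp [Pr]
    have p3 : Pr ww {-1} = ww + X 2 := by simp [Pr]
    have h2 : (X 1 - X 2 : S).IsHomogeneous 1 := (isHomogeneous_X _ _).sub (isHomogeneous_X _ _)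
    have h3 : (ww + X 2 : S).IsHomogeneous 1 := homog_ww.add (isHomogeneous_X _ _)
    refine ⟨-(X 1 - X 2), 1, 0, -(ww + X 2), 0, 1, ⟨?_, ⟨1, by simp, h2.neg⟩,
      ⟨0, by simp, isHomogeneous_one _ _⟩, ⟨0, by simp, isHomogeneous_zero _ _ _⟩⟩,
      ⟨?_, ⟨1, by simp, h3.neg⟩,
      ⟨0, by simp, isHomogeneous_zero _ _ _⟩, ⟨0, by simp, isHomogeneous_one _ _⟩⟩, ?_, ?_, ?_⟩
    · rw [p1, p2, p3]; ring
    · rw [p1, p2, p3]; ring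
    · rw [p1]; ring
    · rw [p2]; ring
    · rw [p3]; ring
  | succ m ih =>
    have t1 := step_eq ih (-m) (by simp only [Finset.mem_Icc]; omega) (by simp only [Int.card_Icc]; omega) (by simp only [Int.card_Icc]; omega) (by
      rw [union_rf (lo := 1 - m) (hi := 2 * m + 1) (by intro t; omega)]; simp only [Int.card_Icc]; omega)
    rw [ins_left (by ring) (by omega)] at t1
    have t2 := step_lt t1 (m + 1) (by simp only [Finset.mem_Icc]; omega) (by simp only [Int.card_Icc]; omega) (by simp only [Int.card_Icc]; omega) (by
      rw [union_rf (lo := -2 * m) (hi := m + 1) (by intro t; omega)]; simp only [Int.card_Icc]; omega)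
    rw [ins_right (by ring) (by omega)] at t2
    have t3 := step_eq t2.rot (-m) (by simp only [Finset.mem_Icc]; omega) (by simp only [Int.card_Icc]; omega) (by simp only [Int.card_Icc]; omega) (by
      rw [union_rf (lo := -m - 1) (hi := 2 * m) (by intro t; omega)]; simp only [Int.card_Icc]; omega)
    rw [ins_left (by ring) (by omega)] at t3
    have t4 := step_lt t3.rot (-m - 2) (by simp only [Finset.mem_Icc]; omega) (by simp only [Int.card_Icc]; omega) (by simp only [Int.card_Icc]; omega) (by
      rw [union_rf (lo := -m) (hi := 2 * m + 2) (by intro t; omega)]; simp only [Int.card_Icc]; omega)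
    rw [ins_left (by ring) (by omega)] at t4
    have t5 := step_eq t4.rot.rot (m + 2) (by simp only [Finset.mem_Icc]; omega) (by simp only [Int.card_Icc]; omega) (by simp only [Int.card_Icc]; omega) (by
      rw [union_rf (lo := -2 * m - 3) (hi := m - 1) (by intro t; omega)]; simp only [Int.card_Icc]; omega)
    rw [ins_right (by ring) (by omega)] at t5
    have t6 := step_lt t5.rot m (by simp only [Finset.mem_Icc]; omega) (by simp only [Int.card_Icc]; omega) (by simp only [Int.card_Icc]; omega) (by
      rw [union_rf (lo := -2 * m - 2) (hi := m + 1) (by intro t; omega)]; simp only [Int.card_Icc]; omega)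
    rw [ins_right (by ring) (by omega)] at t6
    have t7 := t6.rot
    have c1 : 1 - ((m + 1 : ℕ) : ℤ) = -m := by push_cast; ring
    have c2 : ((m + 1 : ℕ) : ℤ) = m + 1 := by push_cast; ring
    have c3 : -((m + 1 : ℕ) : ℤ) - 1 = -m - 2 := by push_cast; ring
    have c4 : ((m + 1 : ℕ) : ℤ) - 1 = m := by push_cast; ring
    have c5 : ((m + 1 : ℕ) : ℤ) + 1 = m + 2 := by push_cast; ring
    rw [c1, c3, c4, c5, c2]
    exact t7

/-! ### The last line -/

theorem Syz.lin {I J K : Finset ℤ} {a : ℕ} {A B E A' B' E' : S}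
    (h : Syz I J K a A B E) (h' : Syz I J K a A' B' E') (s t : ℝ) :
    Syz I J K a (C s * A + C t * A') (C s * B + C t * B') (C s * E + C t * E') := by
  obtain ⟨h, ⟨d1, e1, h1⟩, ⟨d2, e2, h2⟩, ⟨d3, e3, h3⟩⟩ := h
  obtain ⟨h', ⟨d1', e1', h1'⟩, ⟨d2', e2', h2'⟩, ⟨d3', e3', h3'⟩⟩ := h'
  obtain rfl : d1' = d1 := by omega
  obtain rfl : d2' = d2 := by omega
  obtain rfl : d3' = d3 := by omega
  exact ⟨by linear_combination C s * h + C t * h', ⟨_, e1', (h1.C_mul s).add (h1'.C_mul t)⟩,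
    ⟨_, e2', (h2.C_mul s).add (h2'.C_mul t)⟩, ⟨_, e3', (h3.C_mul s).add (h3'.C_mul t)⟩⟩

theorem last_data {I J K : Finset ℤ} {a : ℕ} (h : HB I J K a a) (r : ℤ) (hr : r ∉ I)
    (ha : 0 < a) (hsum : I.card + J.card + K.card = a + a)
    (hn : (J ∪ rf r K).card = a + 1) :
    ∃ A₁ B₁ E₁ A₂ B₂ E₂ : S, ∃ κ : ℝ, κ ≠ 0 ∧ Syz I J K a A₁ B₁ E₁ ∧ Syz I J K a A₂ B₂ E₂ ∧
    B₁ * E₂ - B₂ * E₁ = C κ * Pr (X 0) I ∧ E₁ * A₂ - E₂ * A₁ = C κ * Pr (X 1) J ∧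
    A₁ * B₂ - A₂ * B₁ = C κ * Pr ww K ∧ ev r A₁ = Polynomial.X * Pu (J ∩ rf r K) ∧
    ev r A₂ = Pu (J ∩ rf r K) := by
  obtain ⟨A₁, B₁, E₁, A₂, B₂, E₂, s1, s2, m1, m2, m3⟩ := h
  obtain ⟨c₁, hc₁, hd₁⟩ := s1.dvd r hr (n := a - 1) (by omega)
  obtain ⟨c₂, hc₂, hd₂⟩ := s2.dvd r hr (n := a - 1) (by omega)
  obtain ⟨p₁, q₁, rfl⟩ := Polynomial.exists_eq_X_add_C_of_natDegree_le_one
    (show c₁.natDegree ≤ 1 by omega)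
  obtain ⟨p₂, q₂, rfl⟩ := Polynomial.exists_eq_X_add_C_of_natDegree_le_one
    (show c₂.natDegree ≤ 1 by omega)
  obtain ⟨κ, hκ, hF⟩ := ev_Pr0 r I hr
  set p := Pu (J ∩ rf r K) with hp
  have key : ∀ s t : ℝ, s * p₁ + t * p₂ = 0 → s * q₁ + t * q₂ = 0 → s = 0 ∧ t = 0 := by
    intro s t h1 h2
    have sv := s1.lin s2 s t
    have hA : ev r (C s * A₁ + C t * A₂) = 0 := by
      rw [map_add, map_mul, map_mul, hc₁, hc₂, ev_C, ev_C]
      have h1' := congrArg (Polynomial.C : ℝ →+* Polynomial ℝ) h1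
      have h2' := congrArg (Polynomial.C : ℝ →+* Polynomial ℝ) h2
      simp only [map_add, map_mul, map_zero] at h1' h2'
      linear_combination p * Polynomial.X * h1' + p * h2'
    obtain ⟨hB, hE⟩ := sv.vanish r (by omega) hA
    have e1 := congrArg (ev r) m1
    rw [hF] at e1
    simp only [map_add, map_mul, map_sub, ev_C] at hB hE e1
    have f1 : Polynomial.C s * Polynomial.C κ = 0 := by
      linear_combination ev r E₂ * hB - ev r B₂ * hE - Polynomial.C s * e1
    have f2 : Polynomial.C t * Polynomial.C κ = 0 := by
      linear_combination ev r B₁ * hE - ev r E₁ * hB - Polynomial.C t * e1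
    rw [← Polynomial.C_mul, Polynomial.C_eq_zero] at f1 f2
    exact ⟨(mul_eq_zero.1 f1).resolve_right hκ, (mul_eq_zero.1 f2).resolve_right hκ⟩
  have hD : p₁ * q₂ - p₂ * q₁ ≠ 0 := by
    intro hD
    obtain ⟨-, hp1⟩ := key p₂ (-p₁) (by ring) (by linear_combination -hD)
    obtain ⟨-, hq1⟩ := key q₂ (-q₁) (by linear_combination hD) (by ring)
    have := key 1 0 (by linarith) (by linarith)
    simp at this
  set D := p₁ * q₂ - p₂ * q₁ with hDdef
  have hDC : C (D⁻¹) * (C p₁ * C q₂ - C p₂ * C q₁) = (1 : S) := by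
    rw [← C_mul, ← C_mul, ← C_sub, ← C_mul, ← hDdef, inv_mul_cancel₀ hD, C_1]
  have hDP : Polynomial.C (D⁻¹) * (Polynomial.C p₁ * Polynomial.C q₂ -
      Polynomial.C p₂ * Polynomial.C q₁) = (1 : Polynomial ℝ) := by
    rw [← Polynomial.C_mul, ← Polynomial.C_mul, ← Polynomial.C_sub, ← Polynomial.C_mul, ← hDdef,
      inv_mul_cancel₀ hD, Polynomial.C_1]
  refine ⟨_, _, _, _, _, _, D⁻¹, inv_ne_zero hD, s1.lin s2 (D⁻¹ * q₂) (-(D⁻¹ * q₁)),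
    s1.lin s2 (-(D⁻¹ * p₂)) (D⁻¹ * p₁), ?_, ?_, ?_, ?_, ?_⟩
  · simp only [C_mul, C_neg]
    linear_combination C D⁻¹ * m1 + C D⁻¹ * (B₁ * E₂ - B₂ * E₁) * hDC
  · simp only [C_mul, C_neg]
    linear_combination C D⁻¹ * m2 + C D⁻¹ * (E₁ * A₂ - E₂ * A₁) * hDC
  · simp only [C_mul, C_neg]
    linear_combination C D⁻¹ * m3 + C D⁻¹ * (A₁ * B₂ - A₂ * B₁) * hDC
  · simp only [map_add, map_mul, map_neg, ev_C, hc₁, hc₂]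
    linear_combination p * Polynomial.X * hDP
  · simp only [map_add, map_mul, map_neg, ev_C, hc₁, hc₂]
    linear_combination p * hDP

theorem irr_x (r : ℝ) : Irreducible (X 0 - C r * X 2 : S) :=
  irr_linear (homog_sub_C (isHomogeneous_X _ _) _) (ne_zero_of_eval ![1, 0, 0] (by simp))

theorem irr_y (r : ℝ) : Irreducible (X 1 - C r * X 2 : S) :=
  irr_linear (homog_sub_C (isHomogeneous_X _ _) _) (ne_zero_of_eval ![0, 1, 0] (by simp))

theorem irr_w (r : ℝ) : Irreducible (ww - C r * X 2 : S) :=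
  irr_linear (homog_sub_C homog_ww _) (ne_zero_of_eval ![0, 1, 0] (by simp [ww]))

theorem irr_z : Irreducible (X 2 : S) :=
  irr_linear (isHomogeneous_X _ _) (X_ne_zero 2)

theorem Pr_ne0 (I : Finset ℤ) : Pr (X 0) I ≠ 0 :=
  Finset.prod_ne_zero_iff.2 fun _ _ => (irr_x _).ne_zero
theorem Pr_ne1 (I : Finset ℤ) : Pr (X 1) I ≠ 0 :=
  Finset.prod_ne_zero_iff.2 fun _ _ => (irr_y _).ne_zero
theorem Pr_new (I : Finset ℤ) : Pr ww I ≠ 0 :=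
  Finset.prod_ne_zero_iff.2 fun _ _ => (irr_w _).ne_zero

theorem rel_xy (I J : Finset ℤ) : IsRelPrime (Pr (X 0) I) (Pr (X 1) J) := by
  apply IsRelPrime.prod_left
  intro s _
  apply IsRelPrime.prod_right
  intro t _
  exact relprime_of_eval (irr_x _) ![s, t + 1, 1] (by simp) (by simp)

/-- Hilbert–Burch exactness -/
theorem cramer {F G H κ A₁ B₁ E₁ A₂ B₂ E₂ A B E : S} (hFG : IsRelPrime F G) (hF : F ≠ 0)
    (hκ : IsUnit κ) (m1 : B₁ * E₂ - B₂ * E₁ = κ * F) (m2 : E₁ * A₂ - E₂ * A₁ = κ * G)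
    (m3 : A₁ * B₂ - A₂ * B₁ = κ * H) (s1 : A₁ * F + B₁ * G + E₁ * H = 0)
    (s2 : A₂ * F + B₂ * G + E₂ * H = 0) (s : A * F + B * G + E * H = 0) :
    ∃ u₁ u₂, A = u₁ * A₁ + u₂ * A₂ ∧ B = u₁ * B₁ + u₂ * B₂ ∧ E = u₁ * E₁ + u₂ * E₂ := by
  obtain ⟨ι, hι⟩ := hκ.exists_right_inv
  have par : ∀ {A B E A' B' E' : S}, A * F + B * G + E * H = 0 → A' * F + B' * G + E' * H = 0 →
      ∃ u, B * E' - B' * E = u * F ∧ E * A' - E' * A = u * G ∧ A * B' - A' * B = u * H := by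
    intro A B E A' B' E' s s'
    have h1 : F * (E * A' - E' * A) = G * (B * E' - B' * E) := by
      linear_combination E * s' - E' * s
    have h2 : F * (A * B' - A' * B) = H * (B * E' - B' * E) := by
      linear_combination B' * s - B * s'
    obtain ⟨u, hu⟩ := hFG.dvd_of_dvd_mul_left (Dvd.intro _ h1)
    refine ⟨u, by rw [hu]; ring, ?_, ?_⟩
    · apply mul_left_cancel₀ hF
      rw [h1, hu]; ring
    · apply mul_left_cancel₀ hF
      rw [h2, hu]; ring
  obtain ⟨u, a1, a2, a3⟩ := par s s2
  obtain ⟨v, b1, b2, b3⟩ := par s1 s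
  have hF' : κ * F ≠ 0 := mul_ne_zero hκ.ne_zero hF
  refine ⟨ι * u, ι * v, ?_, ?_, ?_⟩
  · apply mul_left_cancel₀ hF'
    linear_combination κ * s - F * (u * A₁ + v * A₂) * hι + A₁ * a1 + A₂ * b1 + B * m2 + E * m3
  · apply mul_left_cancel₀ hF'
    linear_combination -F * (u * B₁ + v * B₂) * hι + B₁ * a1 + B₂ * b1 - B * m1
  · apply mul_left_cancel₀ hF'
    linear_combination -F * (u * E₁ + v * E₂) * hι + E₁ * a1 + E₂ * b1 - E * m1

theorem sg_Pr1 (r : ℝ) (I : Finset ℤ) : sg r (Pr (X 1) I) = Pr (X 1) I := by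
  simp [Pr, map_prod]

theorem not_dvd_z (r : ℝ) : ¬ (X 0 - C r * X 2 : S) ∣ X 2 := by
  rintro ⟨q, hq⟩
  have := congrArg (eval ![r, 0, 1]) hq
  simp at this

/-- the module of syzygies after adding the last line -/
theorem syz_module {I J K : Finset ℤ} {a : ℕ} (h : HB I J K a a) (r : ℤ) (hr : r ∉ I)
    (hI : I.card < a) (hsum : I.card + J.card + K.card = a + a)
    (hn : (J ∪ rf r K).card = a + 1) :
    ∃ A B E : Fin 3 → S, (∀ i, Syz (insert r I) J K (a + 1) (A i) (B i) (E i)) ∧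
      (∀ U V W : S, U * Pr (X 0) (insert r I) + V * Pr (X 1) J + W * Pr ww K = 0 →
        ∃ u : Fin 3 → S, U = ∑ i, u i * A i ∧ V = ∑ i, u i * B i ∧ W = ∑ i, u i * E i) ∧
      (∀ u : Fin 3 → S, (∑ i, u i * A i = 0 ∧ ∑ i, u i * B i = 0 ∧ ∑ i, u i * E i = 0) ↔
        ∃ v : S, u = fun i => (![X 2, -X 1, -(X 0 - C (r : ℝ) * X 2)] : Fin 3 → S) i * v) := by
  obtain ⟨A₁, B₁, E₁, A₂, B₂, E₂, κ, hκ, s1, s2, m1, m2, m3, e1, e2⟩ :=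
    last_data h r hr (by omega) hsum hn
  set P := Pr (X 1) (J ∩ rf r K) with hP
  have hP0 : P ≠ 0 := Pr_ne1 _
  have hPd : P.IsHomogeneous (J ∩ rf r K).card := homog_Pr (isHomogeneous_X _ _) _
  have hPe : ev r P = Pu (J ∩ rf r K) := ev_Pr1 _ _
  have hcd := Finset.card_union_add_card_inter J (rf r K)
  rw [card_rf] at hcd
  have hκu : IsUnit (C κ : S) := (isUnit_iff_ne_zero.2 hκ).map C
  have hz : (X 2 : S).IsHomogeneous 1 := isHomogeneous_X _ _
  have hy : (X 1 : S).IsHomogeneous 1 := isHomogeneous_X _ _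
  obtain ⟨d, hd, g1⟩ := s1.hA
  obtain ⟨d', hd', g2⟩ := s2.hA
  obtain rfl : d' = d := by omega
  obtain rfl : d' = 1 + (J ∩ rf r K).card := by omega
  have t1 : sg r A₁ = X 1 * P := by
    have := sg_eq_zero_of_ev (g1.sub (hy.mul hPd)) r (by rw [map_sub, map_mul, e1, hPe]; simp)
    rw [map_sub, map_mul, sg_X1, sg_Pr1, sub_eq_zero] at this
    exact this
  have t2 : sg r A₂ = X 2 * P := by
    have := sg_eq_zero_of_ev (g2.sub (hz.mul hPd)) r (by rw [map_sub, map_mul, e2, hPe]; simp)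
    rw [map_sub, map_mul, sg_X2, sg_Pr1, sub_eq_zero] at this
    exact this
  have hα1 : (X 0 - C (r : ℝ) * X 2 : S).IsHomogeneous 1 := homog_sub_C (isHomogeneous_X _ _) _
  have hαsg : sg r (X 0 - C (r : ℝ) * X 2) = 0 := by simp
  have hαp : Prime (X 0 - C (r : ℝ) * X 2 : S) := (irr_x _).prime
  have hαz := not_dvd_z r
  have hsgd := fun A => dvd_sub_sg A r
  obtain ⟨q, hq, hqe⟩ := factor_of_ev (d := 1 + (J ∩ rf r K).card) (A := X 2 * A₁ - X 1 * A₂)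
    (by
      have := (hz.mul g1).sub (hy.mul g2)
      rwa [add_comm 1 (1 + _)] at this) r (by
      rw [map_sub, map_mul, map_mul, e1, e2, ev_X1, ev_X2]; ring)
  have hins := Pr_insert (X 0) hr
  have hcard : (insert r I).card = I.card + 1 := Finset.card_insert_of_notMem hr
  generalize (X 0 - C (r : ℝ) * X 2 : S) = α at *
  have hα0 : α ≠ 0 := hαp.ne_zero
  obtain ⟨n2, f2, k2⟩ := s1.hB
  obtain ⟨n3, f3, k3⟩ := s1.hE
  obtain ⟨n2', f2', k2'⟩ := s2.hB
  obtain ⟨n3', f3', k3'⟩ := s2.hE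
  obtain rfl : n2 = n2' := by omega
  obtain rfl : n3 = n3' := by omega
  refine ⟨![A₁, A₂, q], ![α * B₁, α * B₂, X 2 * B₁ - X 1 * B₂],
    ![α * E₁, α * E₂, X 2 * E₁ - X 1 * E₂], ?_, ?_, ?_⟩
  · intro i
    fin_cases i
    · refine ⟨?_, ⟨_, by omega, g1⟩, ⟨_, by omega, hα1.mul k2⟩, ⟨_, by omega, hα1.mul k3⟩⟩
      simp only [Fin.zero_eta, Matrix.cons_val_zero]
      rw [hins]
      linear_combination α * s1.eq
    · refine ⟨?_, ⟨_, by omega, g2⟩, ⟨_, by omega, hα1.mul k2'⟩, ⟨_, by omega, hα1.mul k3'⟩⟩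
      simp only [Fin.mk_one, Matrix.cons_val_one, Matrix.cons_val_zero]
      rw [hins]
      linear_combination α * s2.eq
    · refine ⟨?_, ⟨_, by omega, hq⟩, ⟨1 + n2, by omega, (hz.mul k2).sub (hy.mul k2')⟩,
        ⟨1 + n3, by omega, (hz.mul k3).sub (hy.mul k3')⟩⟩
      simp only [Fin.reduceFinMk, Matrix.cons_val]
      rw [hins]
      linear_combination X 2 * s1.eq - X 1 * s2.eq - Pr (X 0) I * hqe
  · intro U V W hUVW
    rw [hins] at hUVW
    obtain ⟨u₁, u₂, c1, c2, c3⟩ := cramer (rel_xy I J) (Pr_ne0 I) hκu m1 m2 m3 s1.eq s2.eq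
      (A := α * U) (B := V) (E := W) (by linear_combination hUVW)
    have c4 : X 1 * sg r u₁ + X 2 * sg r u₂ = 0 := by
      apply mul_left_cancel₀ hP0
      have := congrArg (sg r) c1
      rw [map_mul, hαsg, map_add, map_mul, map_mul, t1, t2] at this
      linear_combination -this
    have c5 : (X 2 : S) ∣ sg r u₁ := by
      have : (X 2 : S) ∣ X 1 * sg r u₁ := ⟨-sg r u₂, by linear_combination c4⟩
      refine (irr_z.prime.dvd_or_dvd this).resolve_left ?_
      rintro ⟨t, ht⟩
      have := congrArg (eval ![0, 1, 0]) ht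
      simp at this
    obtain ⟨k, hk⟩ := c5
    have hk2 : sg r u₂ = -X 1 * k := by
      apply mul_left_cancel₀ (X_ne_zero (R := ℝ) (2 : Fin 3))
      linear_combination c4 - X 1 * hk
    obtain ⟨w₁, hw₁⟩ := hsgd u₁
    obtain ⟨w₂, hw₂⟩ := hsgd u₂
    refine ⟨![w₁, w₂, k], ?_, ?_, ?_⟩
    · apply mul_left_cancel₀ hα0
      simp only [Fin.sum_univ_three, Matrix.cons_val]
      linear_combination c1 + A₁ * (hw₁ + hk) + A₂ * (hw₂ + hk2) + k * hqe
    · simp only [Fin.sum_univ_three, Matrix.cons_val]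
      linear_combination c2 + B₁ * (hw₁ + hk) + B₂ * (hw₂ + hk2)
    · simp only [Fin.sum_univ_three, Matrix.cons_val]
      linear_combination c3 + E₁ * (hw₁ + hk) + E₂ * (hw₂ + hk2)
  · intro u
    simp only [Fin.sum_univ_three, Matrix.cons_val]
    constructor
    · rintro ⟨c1, c2, c3⟩
      have hκF : C κ * Pr (X 0) I ≠ 0 := mul_ne_zero hκu.ne_zero (Pr_ne0 I)
      have x1 : α * u 0 + X 2 * u 2 = 0 := by
        apply mul_left_cancel₀ hκF
        linear_combination E₂ * c2 - B₂ * c3 - (α * u 0 + X 2 * u 2) * m1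
      have x2 : α * u 1 - X 1 * u 2 = 0 := by
        apply mul_left_cancel₀ hκF
        linear_combination B₁ * c3 - E₁ * c2 - (α * u 1 - X 1 * u 2) * m1
      have x3 : α ∣ u 2 :=
        (hαp.dvd_or_dvd (show α ∣ X 2 * u 2 from ⟨-u 0, by linear_combination x1⟩)).resolve_left hαz
      obtain ⟨v, hv⟩ := x3
      refine ⟨-v, ?_⟩
      funext i
      fin_cases i
      · simp only [Fin.zero_eta, Matrix.cons_val]
        apply mul_left_cancel₀ hα0
        linear_combination x1 - X 2 * hv
      · simp only [Fin.mk_one, Matrix.cons_val]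
        apply mul_left_cancel₀ hα0
        linear_combination x2 + X 1 * hv
      · simp only [Fin.reduceFinMk, Matrix.cons_val]
        linear_combination hv
    · rintro ⟨v, rfl⟩
      simp only [Matrix.cons_val]
      refine ⟨?_, by ring, by ring⟩
      linear_combination v * hqe

/-! ### Derivations and syzygies -/

theorem der_Pr {l : S} (hl : l.IsHomogeneous 1) (I : Finset ℤ) :
    ∃ N : S, N.IsHomogeneous (I.card - 1) ∧ (I.card = 0 → N = 0) ∧
      ∀ (δ : Derivation ℝ S S) (P T : S), δ l = P - T * l → δ (X 2) = -T * X 2 →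
        δ (Pr l I) = P * N - C (I.card : ℝ) * T * Pr l I := by
  induction I using Finset.induction_on with
  | empty => exact ⟨0, isHomogeneous_zero _ _ _, fun _ => rfl, fun δ P T _ _ => by simp [Pr]⟩
  | insert r I hr ih =>
    obtain ⟨N, h1, h2, h3⟩ := ih
    rw [Finset.card_insert_of_notMem hr]
    refine ⟨Pr l I + (l - C (r : ℝ) * X 2) * N, ?_, by simp, ?_⟩
    · apply (homog_Pr hl I).add
      rcases Nat.eq_zero_or_pos I.card with h | h
      · rw [h2 h, mul_zero]; exact isHomogeneous_zero _ _ _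
      · have := (homog_sub_C hl r).mul h1
        rwa [Nat.add_sub_cancel' h] at this
    · intro δ P T e1 e2
      rw [Pr_insert l hr, Derivation.leibniz, h3 δ P T e1 e2, map_sub, Derivation.leibniz, e1, e2,
        derivation_C]
      simp only [smul_eq_mul, Nat.cast_add, Nat.cast_one, C_add, C_1]
      ring

theorem dvd_der {l g : S} (hg : IsRelPrime l g) (δ : Derivation ℝ S S) (h : δ (l * g) = 0) :
    l ∣ δ l := by
  rw [Derivation.leibniz, smul_eq_mul, smul_eq_mul] at h
  apply hg.dvd_of_dvd_mul_left
  exact ⟨-δ g, by linear_combination h⟩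

theorem sub_ne_of {s t : ℤ} (h : s ≠ t) : (s : ℝ) - t ≠ 0 := by
  rw [sub_ne_zero]; exact_mod_cast h

theorem rel_xx {s t : ℤ} (h : s ≠ t) :
    IsRelPrime (X 0 - C (s : ℝ) * X 2 : S) (X 0 - C (t : ℝ) * X 2) :=
  relprime_of_eval (irr_x _) ![s, 0, 1] (by simp) (by simpa using sub_ne_of h)
theorem rel_yy {s t : ℤ} (h : s ≠ t) :
    IsRelPrime (X 1 - C (s : ℝ) * X 2 : S) (X 1 - C (t : ℝ) * X 2) :=
  relprime_of_eval (irr_y _) ![0, s, 1] (by simp) (by simpa using sub_ne_of h)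
theorem rel_ww {s t : ℤ} (h : s ≠ t) :
    IsRelPrime (ww - C (s : ℝ) * X 2 : S) (ww - C (t : ℝ) * X 2) :=
  relprime_of_eval (irr_w _) ![-s, 0, 1] (by simp [ww]) (by simpa [ww] using sub_ne_of h)
theorem rel_xy' (s t : ℤ) :
    IsRelPrime (X 0 - C (s : ℝ) * X 2 : S) (X 1 - C (t : ℝ) * X 2) :=
  relprime_of_eval (irr_x _) ![s, t + 1, 1] (by simp) (by simp)
theorem rel_xw (s t : ℤ) :
    IsRelPrime (X 0 - C (s : ℝ) * X 2 : S) (ww - C (t : ℝ) * X 2) :=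
  relprime_of_eval (irr_x _) ![s, -s - t - 1, 1] (by simp) (by
    simp [ww]; ring_nf; norm_num)
theorem rel_yw (s t : ℤ) :
    IsRelPrime (X 1 - C (s : ℝ) * X 2 : S) (ww - C (t : ℝ) * X 2) :=
  relprime_of_eval (irr_y _) ![-s - t - 1, s, 1] (by simp) (by
    simp [ww]; intro h; linarith)
theorem rel_zx (t : ℤ) : IsRelPrime (X 2 : S) (X 0 - C (t : ℝ) * X 2) :=
  relprime_of_eval irr_z ![1, 1, 0] (by simp) (by simp)
theorem rel_zy (t : ℤ) : IsRelPrime (X 2 : S) (X 1 - C (t : ℝ) * X 2) :=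
  relprime_of_eval irr_z ![1, 1, 0] (by simp) (by simp)
theorem rel_zw (t : ℤ) : IsRelPrime (X 2 : S) (ww - C (t : ℝ) * X 2) :=
  relprime_of_eval irr_z ![1, 1, 0] (by simp) (by simp [ww])

/-- the reduced defining polynomial, up to a unit -/
def ff (I J K : Finset ℤ) : S := X 2 * Pr (X 0) I * Pr (X 1) J * Pr ww K

theorem Pr_erase (l : S) {I : Finset ℤ} {s : ℤ} (h : s ∈ I) :
    Pr l I = (l - C (s : ℝ) * X 2) * Pr l (I.erase s) :=
  (Finset.mul_prod_erase I (fun s : ℤ => l - C (s : ℝ) * X 2) h).symm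

theorem z_dvd {I J K : Finset ℤ} (δ : Derivation ℝ S S) (h : δ (ff I J K) = 0) :
    X 2 ∣ δ (X 2) := by
  refine dvd_der (g := Pr (X 0) I * Pr (X 1) J * Pr ww K) ?_ δ (by rw [← h, ff]; congr 1; ring)
  exact ((IsRelPrime.prod_right fun t _ => rel_zx t).mul_right
    (IsRelPrime.prod_right fun t _ => rel_zy t)).mul_right
    (IsRelPrime.prod_right fun t _ => rel_zw t)

theorem x_dvd {I J K : Finset ℤ} (δ : Derivation ℝ S S) (h : δ (ff I J K) = 0) {s : ℤ}
    (hs : s ∈ I) : (X 0 - C (s : ℝ) * X 2) ∣ δ (X 0 - C (s : ℝ) * X 2) := by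
  refine dvd_der (g := X 2 * Pr (X 0) (I.erase s) * Pr (X 1) J * Pr ww K) ?_ δ
    (by rw [← h, ff, Pr_erase _ hs]; congr 1; ring)
  refine (((rel_zx s).symm.mul_right (IsRelPrime.prod_right fun t ht => rel_xx ?_)).mul_right
    (IsRelPrime.prod_right fun t _ => rel_xy' s t)).mul_right
    (IsRelPrime.prod_right fun t _ => rel_xw s t)
  exact (Finset.ne_of_mem_erase ht).symm

theorem y_dvd {I J K : Finset ℤ} (δ : Derivation ℝ S S) (h : δ (ff I J K) = 0) {s : ℤ}
    (hs : s ∈ J) : (X 1 - C (s : ℝ) * X 2) ∣ δ (X 1 - C (s : ℝ) * X 2) := by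
  refine dvd_der (g := X 2 * Pr (X 0) I * Pr (X 1) (J.erase s) * Pr ww K) ?_ δ
    (by rw [← h, ff, Pr_erase _ hs]; congr 1; ring)
  refine (((rel_zy s).symm.mul_right (IsRelPrime.prod_right fun t _ =>
    (rel_xy' t s).symm)).mul_right
    (IsRelPrime.prod_right fun t ht => rel_yy ?_)).mul_right
    (IsRelPrime.prod_right fun t _ => rel_yw s t)
  exact (Finset.ne_of_mem_erase ht).symm

theorem w_dvd {I J K : Finset ℤ} (δ : Derivation ℝ S S) (h : δ (ff I J K) = 0) {s : ℤ}
    (hs : s ∈ K) : (ww - C (s : ℝ) * X 2) ∣ δ (ww - C (s : ℝ) * X 2) := by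
  refine dvd_der (g := X 2 * Pr (X 0) I * Pr (X 1) J * Pr ww (K.erase s)) ?_ δ
    (by rw [← h, ff, Pr_erase _ hs]; congr 1; ring)
  refine (((rel_zw s).symm.mul_right (IsRelPrime.prod_right fun t _ =>
    (rel_xw t s).symm)).mul_right
    (IsRelPrime.prod_right fun t _ => (rel_yw t s).symm)).mul_right
    (IsRelPrime.prod_right fun t ht => rel_ww ?_)
  exact (Finset.ne_of_mem_erase ht).symm

theorem Pr_dvd_of {l : S} {I : Finset ℤ} {δ : Derivation ℝ S S} {e : S} (he : δ (X 2) = X 2 * e)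
    (hrel : ∀ s t : ℤ, s ≠ t → IsRelPrime (l - C (s : ℝ) * X 2) (l - C (t : ℝ) * X 2))
    (h : ∀ s ∈ I, (l - C (s : ℝ) * X 2) ∣ δ (l - C (s : ℝ) * X 2)) :
    Pr l I ∣ δ l - e * l := by
  apply Finset.prod_dvd_of_isRelPrime
  · intro s _ t _ hst
    exact hrel s t hst
  · intro s hs
    obtain ⟨q, hq⟩ := h s hs
    refine ⟨q - e, ?_⟩
    rw [map_sub, Derivation.leibniz, derivation_C, he, smul_eq_mul, smul_eq_mul] at hq
    linear_combination hq

/-- the correspondence between syzygies and derivations -/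
theorem correspondence (I J K : Finset ℤ) :
    ∃ Θ : S → S → S → Derivation ℝ S S,
      (∀ A B E, A * Pr (X 0) I + B * Pr (X 1) J + E * Pr ww K = 0 → Θ A B E (ff I J K) = 0) ∧
      (∀ δ : Derivation ℝ S S, δ (ff I J K) = 0 → ∃ A B E,
        A * Pr (X 0) I + B * Pr (X 1) J + E * Pr ww K = 0 ∧ Θ A B E = δ) ∧
      (∀ (u A B E : Fin 3 → S), ∑ i, u i • Θ (A i) (B i) (E i) =
        Θ (∑ i, u i * A i) (∑ i, u i * B i) (∑ i, u i * E i)) ∧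
      (∀ A B E, A * Pr (X 0) I + B * Pr (X 1) J + E * Pr ww K = 0 →
        (Θ A B E = 0 ↔ A = 0 ∧ B = 0 ∧ E = 0)) ∧
      (0 < I.card → 0 < J.card → 0 < K.card →
        ∀ a A B E, Syz I J K a A B E → IsHomogDer (Θ A B E) a) := by
  obtain ⟨N₁, hN₁, -, d₁⟩ := der_Pr (isHomogeneous_X ℝ (0 : Fin 3)) I
  obtain ⟨N₂, hN₂, -, d₂⟩ := der_Pr (isHomogeneous_X ℝ (1 : Fin 3)) J
  obtain ⟨N₃, hN₃, -, d₃⟩ := der_Pr homog_ww K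
  set n : ℝ := 1 + I.card + J.card + K.card with hn
  have hn0 : n ≠ 0 := by positivity
  have hnC : (C n * C n⁻¹ : S) = 1 := by rw [← C_mul, mul_inv_cancel₀ hn0, C_1]
  have hnC' : (C n : S) = 1 + C (I.card : ℝ) + C (J.card : ℝ) + C (K.card : ℝ) := by
    rw [hn]; simp only [C_add, C_1]
  let T : S → S → S → S := fun A B E => C n⁻¹ * (A * N₁ + B * N₂ + E * N₃)
  have hT : ∀ A B E, T A B E = C n⁻¹ * (A * N₁ + B * N₂ + E * N₃) := fun _ _ _ => rfl
  let Θ : S → S → S → Derivation ℝ S S := fun A B E => mkDerivation ℝ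
    ![A * Pr (X 0) I - T A B E * X 0, B * Pr (X 1) J - T A B E * X 1, -T A B E * X 2]
  have x0 : ∀ A B E, Θ A B E (X 0) = A * Pr (X 0) I - T A B E * X 0 := fun A B E => by
    simp [Θ, mkDerivation_X]
  have x1 : ∀ A B E, Θ A B E (X 1) = B * Pr (X 1) J - T A B E * X 1 := fun A B E => by
    simp [Θ, mkDerivation_X]
  have x2 : ∀ A B E, Θ A B E (X 2) = -T A B E * X 2 := fun A B E => by
    simp [Θ, mkDerivation_X]
  have main : ∀ (δ : Derivation ℝ S S) (A B E t : S), δ (X 0) = A * Pr (X 0) I - t * X 0 →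
      δ (X 1) = B * Pr (X 1) J - t * X 1 → δ (X 2) = -t * X 2 →
      A * Pr (X 0) I + B * Pr (X 1) J + E * Pr ww K = 0 →
      δ (ff I J K) = (A * N₁ + B * N₂ + E * N₃ - C n * t) * ff I J K := by
    intro δ A B E t h0 h1 h2 hs
    have h3 : δ ww = E * Pr ww K - t * ww := by
      rw [ww, map_neg, map_add, h0, h1]
      rw [ww] at hs
      linear_combination -hs
    rw [ff, Derivation.leibniz, Derivation.leibniz, Derivation.leibniz, d₁ δ _ t h0 h2,
      d₂ δ _ t h1 h2, d₃ δ _ t h3 h2, h2, hnC']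
    simp only [smul_eq_mul]
    ring
  have hff : ff I J K ≠ 0 := mul_ne_zero (mul_ne_zero (mul_ne_zero (X_ne_zero 2) (Pr_ne0 I))
    (Pr_ne1 J)) (Pr_new K)
  refine ⟨Θ, ?_, ?_, ?_, ?_, ?_⟩
  · intro A B E hs
    rw [main _ A B E _ (x0 A B E) (x1 A B E) (x2 A B E) hs, hT]
    linear_combination (-(A * N₁ + B * N₂ + E * N₃) * ff I J K) * hnC
  · intro δ hδ
    obtain ⟨e, he⟩ := z_dvd δ hδ
    obtain ⟨A, hA⟩ := Pr_dvd_of he (fun s t h => rel_xx h) (fun s hs => x_dvd δ hδ hs)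
    obtain ⟨B, hB⟩ := Pr_dvd_of he (fun s t h => rel_yy h) (fun s hs => y_dvd δ hδ hs)
    obtain ⟨E, hE⟩ := Pr_dvd_of he (fun s t h => rel_ww h) (fun s hs => w_dvd δ hδ hs)
    have hs : A * Pr (X 0) I + B * Pr (X 1) J + E * Pr ww K = 0 := by
      have : δ ww = -(δ (X 0) + δ (X 1)) := by rw [ww, map_neg, map_add]
      have hw : ww = -(X 0 + X 1) := rfl
      linear_combination -hA - hB - hE + this - e * hw
    have h4 := main δ A B E (-e) (by linear_combination hA) (by linear_combination hB)
      (by linear_combination he) hs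
    rw [hδ] at h4
    have h5 := (mul_eq_zero.1 h4.symm).resolve_right hff
    have h6 : T A B E = -e := by
      rw [hT]
      linear_combination C n⁻¹ * h5 - e * hnC
    refine ⟨A, B, E, hs, ?_⟩
    apply derivation_ext
    intro i
    fin_cases i
    · refine (x0 A B E).trans ?_
      change _ = δ (X 0)
      rw [h6]
      linear_combination -hA
    · refine (x1 A B E).trans ?_
      change _ = δ (X 1)
      rw [h6]
      linear_combination -hB
    · refine (x2 A B E).trans ?_
      change _ = δ (X 2)
      rw [h6]
      linear_combination -he
  · intro u A B E
    apply derivation_ext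
    intro i
    simp only [Fin.sum_univ_three, Derivation.add_apply, Derivation.smul_apply, smul_eq_mul]
    fin_cases i
    · simp only [Fin.zero_eta, x0, hT]; ring
    · simp only [Fin.mk_one, x1, hT]; ring
    · simp only [Fin.reduceFinMk, x2, hT]; ring
  · intro A B E hs
    constructor
    · intro h
      have y2 := x2 A B E
      have y0 := x0 A B E
      have y1 := x1 A B E
      rw [h, Derivation.zero_apply] at y0 y1 y2
      have hT0 : T A B E = 0 := by
        have := (mul_eq_zero.1 y2.symm).resolve_right (X_ne_zero 2)
        simpa using this
      rw [hT0, zero_mul, sub_zero] at y0 y1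
      have hA := (mul_eq_zero.1 y0.symm).resolve_right (Pr_ne0 I)
      have hB := (mul_eq_zero.1 y1.symm).resolve_right (Pr_ne1 J)
      refine ⟨hA, hB, ?_⟩
      rw [hA, hB, zero_mul, zero_mul, zero_add, zero_add] at hs
      exact (mul_eq_zero.1 hs).resolve_right (Pr_new K)
    · rintro ⟨rfl, rfl, rfl⟩
      apply derivation_ext
      intro i
      fin_cases i
      · refine (x0 _ _ _).trans ?_; simp [hT]
      · refine (x1 _ _ _).trans ?_; simp [hT]
      · refine (x2 _ _ _).trans ?_; simp [hT]
  · intro hI hJ hK a A B E hs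
    obtain ⟨-, ⟨k1, e1, h1⟩, ⟨k2, e2, h2⟩, ⟨k3, e3, h3⟩⟩ := hs
    obtain ⟨b, rfl⟩ : ∃ b, a = b + 1 := ⟨a - 1, by omega⟩
    have hTh : (T A B E).IsHomogeneous b := by
      apply IsHomogeneous.C_mul
      have f1 := h1.mul hN₁
      have f2 := h2.mul hN₂
      have f3 := h3.mul hN₃
      rw [show k1 + (I.card - 1) = b by omega] at f1
      rw [show k2 + (J.card - 1) = b by omega] at f2
      rw [show k3 + (K.card - 1) = b by omega] at f3
      exact (f1.add f2).add f3
    have g1 := h1.mul (homog_Pr (isHomogeneous_X ℝ (0 : Fin 3)) I)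
    have g2 := h2.mul (homog_Pr (isHomogeneous_X ℝ (1 : Fin 3)) J)
    rw [e1] at g1
    rw [e2] at g2
    intro i
    fin_cases i
    · have := g1.sub (hTh.mul (isHomogeneous_X ℝ (0 : Fin 3)))
      rw [← x0] at this
      exact this
    · have := g2.sub (hTh.mul (isHomogeneous_X ℝ (1 : Fin 3)))
      rw [← x1] at this
      exact this
    · have := hTh.neg.mul (isHomogeneous_X ℝ (2 : Fin 3))
      rw [← x2] at this
      exact this

theorem ff_eq (j : ℕ) : ∃ c : ℝ, c ≠ 0 ∧
    ff (Finset.Icc (-(j : ℤ)) (j + 2)) (Finset.Icc (-(j : ℤ)) (j + 2))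
      (Finset.Icc (-(j : ℤ) - 2) j) = C c * fjk j 2 := by
  have hK : Finset.Icc (-(j : ℤ) - 2) j = (Finset.Icc (-(j : ℤ)) (j + 2)).image (fun s => -s) := by
    ext t
    simp only [Finset.mem_image, Finset.mem_Icc]
    constructor
    · intro h
      exact ⟨-t, by omega, by omega⟩
    · rintro ⟨s, h, rfl⟩
      omega
  have hP : Pr ww (Finset.Icc (-(j : ℤ) - 2) j) =
      ∏ s ∈ Finset.Icc (-(j : ℤ)) (j + 2), (-1 : S) * (X 0 + X 1 - C (s : ℝ) * X 2) := by
    rw [Pr, hK, Finset.prod_image (fun a _ b _ h => neg_injective h)]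
    apply Finset.prod_congr rfl
    intro s _
    rw [ww, Int.cast_neg, C_neg]
    ring
  refine ⟨(-1) ^ (Finset.Icc (-(j : ℤ)) (j + 2)).card, by simp, ?_⟩
  rw [ff, hP, fjk, Finset.prod_mul_distrib, Finset.prod_const, Finset.prod_mul_distrib,
    Finset.prod_mul_distrib, C_pow, C_neg, C_1]
  rw [show (((2 : ℕ) : ℤ) + (j : ℤ)) = j + 2 by push_cast; ring]
  simp only [Pr]
  ring

theorem mem_D0_iff (j : ℕ) (δ : Derivation ℝ S S) : δ ∈ D0 (fjk j 2) ↔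
    δ (ff (Finset.Icc (-(j : ℤ)) (j + 2)) (Finset.Icc (-(j : ℤ)) (j + 2))
      (Finset.Icc (-(j : ℤ) - 2) j)) = 0 := by
  obtain ⟨c, hc, h⟩ := ff_eq j
  have : δ ∈ D0 (fjk j 2) ↔ δ (fjk j 2) = 0 := Iff.rfl
  rw [this, h, Derivation.leibniz, derivation_C, smul_zero, add_zero, smul_eq_mul, mul_eq_zero]
  simp [hc]

/-- For `k = 2` the logarithmic bundle is `T_{ℙ²}(-6-3j)`: there is an exact sequence
`0 → S → S³ → D_0(f_{j,2}) → 0` given by three independent linear forms and three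
derivations homogeneous of degree `3j+5`. -/
theorem k_two_is_twisted_tangent_bundle (j : ℕ) :
    ∃ (ℓ : Fin 3 → S) (θ : Fin 3 → Derivation ℝ S S),
      (∀ i, (ℓ i).IsHomogeneous 1) ∧ LinearIndependent ℝ ℓ ∧
      (∀ i, θ i ∈ D0 (fjk j 2)) ∧
      (∀ i, IsHomogDer (θ i) (3 * j + 5)) ∧
      Function.Injective (fun v : S => fun i => ℓ i * v) ∧
      (∀ a : Fin 3 → S, (∑ i, a i • θ i) = 0 ↔ ∃ v : S, (fun i => ℓ i * v) = a) ∧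
      (∀ δ ∈ D0 (fjk j 2), ∃ a : Fin 3 → S, ∑ i, a i • θ i = δ) := by
  have hb := HB_chain (j + 1)
  have hI : Finset.Icc (1 - ((j + 1 : ℕ) : ℤ)) ((j + 1 : ℕ) : ℤ) = Finset.Icc (-(j : ℤ)) (j + 1) := by
    congr 1 <;> push_cast <;> ring
  have hJ : Finset.Icc (1 - ((j + 1 : ℕ) : ℤ)) (((j + 1 : ℕ) : ℤ) + 1) =
      Finset.Icc (-(j : ℤ)) (j + 2) := by
    congr 1 <;> push_cast <;> ring
  have hK : Finset.Icc (-((j + 1 : ℕ) : ℤ) - 1) (((j + 1 : ℕ) : ℤ) - 1) =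
      Finset.Icc (-(j : ℤ) - 2) j := by
    congr 1 <;> push_cast <;> ring
  rw [hI, hJ, hK] at hb
  obtain ⟨A, B, E, hsyz, hgen, hrel⟩ := syz_module hb ((j : ℤ) + 2)
    (by simp only [Finset.mem_Icc]; omega)
    (by simp only [Int.card_Icc]; omega) (by simp only [Int.card_Icc]; omega)
    (by
      rw [union_rf (lo := -2 * (j : ℤ) - 2) (hi := (j : ℤ) + 2) (by intro t; omega)]
      simp only [Int.card_Icc]; omega)
  have hins : insert ((j : ℤ) + 2) (Finset.Icc (-(j : ℤ)) (j + 1)) =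
      Finset.Icc (-(j : ℤ)) (j + 2) := ins_right (by ring) (by omega)
  rw [hins] at hsyz hgen
  obtain ⟨Θ, t1, t2, t3, t4, t5⟩ := correspondence (Finset.Icc (-(j : ℤ)) (j + 2))
    (Finset.Icc (-(j : ℤ)) (j + 2)) (Finset.Icc (-(j : ℤ) - 2) j)
  refine ⟨![X 2, -X 1, -(X 0 - C (((j : ℤ) + 2 : ℤ) : ℝ) * X 2)],
    fun i => Θ (A i) (B i) (E i), ?_, ?_, ?_, ?_, ?_, ?_, ?_⟩
  · intro i
    fin_cases i
    · exact isHomogeneous_X ℝ (2 : Fin 3)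
    · exact (isHomogeneous_X ℝ (1 : Fin 3)).neg
    · exact (homog_sub_C (isHomogeneous_X ℝ (0 : Fin 3)) _).neg
  · rw [Fintype.linearIndependent_iff]
    intro g hg
    rw [Fin.sum_univ_three] at hg
    have e0 := congrArg (eval (![1, 0, 0] : Fin 3 → ℝ)) hg
    have e1 := congrArg (eval (![0, 1, 0] : Fin 3 → ℝ)) hg
    have e2 := congrArg (eval (![0, 0, 1] : Fin 3 → ℝ)) hg
    simp [smul_eval] at e0 e1 e2
    rw [e0] at e2
    simp at e2
    intro i
    fin_cases i
    · exact e2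
    · exact e1
    · exact e0
  · intro i
    exact (mem_D0_iff j _).2 (t1 _ _ _ (hsyz i).eq)
  · intro i
    have := t5 (by simp only [Int.card_Icc]; omega) (by simp only [Int.card_Icc]; omega)
      (by simp only [Int.card_Icc]; omega) _ _ _ _ (hsyz i)
    exact this
  · intro v w h
    have := congrFun h 0
    exact mul_left_cancel₀ (X_ne_zero (2 : Fin 3)) this
  · intro a
    rw [t3, t4]
    · rw [hrel]
      exact exists_congr fun v => eq_comm
    · simp only [Fin.sum_univ_three]
      linear_combination a 0 * (hsyz 0).eq + a 1 * (hsyz 1).eq + a 2 * (hsyz 2).eq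
  · intro δ hδ
    obtain ⟨U, V, W, hs, rfl⟩ := t2 δ ((mem_D0_iff j δ).1 hδ)
    obtain ⟨u, rfl, rfl, rfl⟩ := hgen U V W hs
    exact ⟨u, t3 u A B E⟩
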